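/- Let E, F be real Banach spaces, Ω, Ω' ⊆ ℝ^p nonempty open sets, n ≥ 1. Let J : Ω' → L(E, F) be a map of class s-C^n, and let h be a diffeomorphism of class C^n from Ω' onto Ω. If, for f ∈ C^n(Ω, E), one defines (Tf)(y) := (Jy)(f(h(y))) for every y ∈ Ω', then Tf ∈ C^n(Ω', F). -/

import Mathlib

open Set Filter Topology

/-- The partial derivative of `f` with respect to the `i`-th coordinate. -/
noncomputable def partialD {p : ℕ} {E : Type*} [NormedAddCommGroup E] [NormedSpace ℝ E]
    (i : Fin p) (f : (Fin p → ℝ) → E) : (Fin p → ℝ) → E :=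
  fun x => fderiv ℝ f x (Pi.single i 1)

/-- The iterated partial derivative `∂^λ f` associated with a multi-index `λ`. -/
noncomputable def pdMulti {p : ℕ} {E : Type*} [NormedAddCommGroup E] [NormedSpace ℝ E]
    (lam : Fin p → ℕ) (f : (Fin p → ℝ) → E) : (Fin p → ℝ) → E :=
  (List.finRange p).foldr (fun i g => (partialD i)^[lam i] g) f

/-- A map `K : Ω' → L(E, F)` is of class `s-C¹` if it is norm-continuous, for every `e ∈ E` the
map `y ↦ (Ky)(e)` admits all first-order partial derivatives on `Ω'`, for each `i` and `y` the
assignment `e ↦ ∂K_e/∂x_i (y)` is a bounded linear operator `(∂ₛK/∂x_i)(y) ∈ L(E,F)`, and each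
`∂ₛK/∂x_i : Ω' → L(E, F)` is continuous for the strong operator topology. -/
def IsSC1 {p : ℕ} {E F : Type*} [NormedAddCommGroup E] [NormedSpace ℝ E]
    [NormedAddCommGroup F] [NormedSpace ℝ F]
    (Ω' : Set (Fin p → ℝ)) (K : (Fin p → ℝ) → (E →L[ℝ] F)) : Prop :=
  ContinuousOn K Ω' ∧
  ∃ K' : Fin p → (Fin p → ℝ) → (E →L[ℝ] F),
    (∀ (i : Fin p) (e : E), ∀ y ∈ Ω',
      HasLineDerivAt ℝ (fun z => K z e) (K' i y e) y (Pi.single i 1)) ∧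
    (∀ (i : Fin p) (e : E), ContinuousOn (fun y => K' i y e) Ω')

/-- `J : Ω' → L(E, F)` is of class `s-Cⁿ` if it is of class `C^{n-1}` (into the Banach space
`L(E, F)`) and all of its partial derivatives of order `n - 1` are of class `s-C¹`. -/
def IsSCn {p : ℕ} {E F : Type*} [NormedAddCommGroup E] [NormedSpace ℝ E]
    [NormedAddCommGroup F] [NormedSpace ℝ F]
    (n : ℕ) (Ω' : Set (Fin p → ℝ)) (J : (Fin p → ℝ) → (E →L[ℝ] F)) : Prop :=
  ContDiffOn ℝ (n - 1 : ℕ) J Ω' ∧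
  ∀ lam : Fin p → ℕ, (∑ i, lam i) = n - 1 → IsSC1 Ω' (pdMulti lam J)

section

variable {p : ℕ} {E F : Type*} [NormedAddCommGroup E] [NormedSpace ℝ E]
  [NormedAddCommGroup F] [NormedSpace ℝ F]

section PartialDerivatives

variable {Ω : Set (Fin p → ℝ)} {f g : (Fin p → ℝ) → E}

/-- Mean value estimate along one coordinate direction. -/
theorem norm_sub_sub_smul_le_of_hasLineDerivAt {v x : Fin p → ℝ} {d : (Fin p → ℝ) → E} {c : E}
    {ε a : ℝ}
    (hd : ∀ t ∈ uIcc 0 a, HasLineDerivAt ℝ f (d (x + t • v)) (x + t • v) v)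
    (hb : ∀ t ∈ uIcc 0 a, ‖d (x + t • v) - c‖ ≤ ε) :
    ‖f (x + a • v) - f x - a • c‖ ≤ ε * |a| := by
  have key : ∀ t ∈ uIcc 0 a, HasDerivWithinAt (fun t : ℝ => f (x + t • v) - t • c)
      (d (x + t • v) - c) (uIcc 0 a) t := by
    intro t ht
    have h1 : HasDerivAt (fun s : ℝ => f (x + t • v + s • v)) (d (x + t • v)) (t - t) := by
      simpa [HasLineDerivAt] using hd t ht
    have h2 := h1.comp_sub_const t t
    have h3 : HasDerivAt (fun s : ℝ => f (x + s • v)) (d (x + t • v)) t := by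
      refine h2.congr_of_eventuallyEq (Eventually.of_forall fun s => ?_)
      simp only [add_assoc, ← add_smul, add_sub_cancel]
    have h4 : HasDerivAt (fun t : ℝ => t • c) c t := by
      simpa using (hasDerivAt_id t).smul_const c
    exact (h3.sub h4).hasDerivWithinAt
  have := (convex_uIcc (0 : ℝ) a).norm_image_sub_le_of_norm_hasDerivWithin_le key hb
    left_mem_uIcc right_mem_uIcc
  simpa [sub_right_comm] using this

/-- A function all of whose partial derivatives exist and are continuous on an open set is
differentiable there. -/
theorem hasFDerivAt_of_hasLineDerivAt_single (hΩ : IsOpen Ω) {d : Fin p → (Fin p → ℝ) → E}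
    (hd : ∀ i, ∀ y ∈ Ω, HasLineDerivAt ℝ f (d i y) y (Pi.single i 1))
    (hc : ∀ i, ContinuousOn (d i) Ω) {y : Fin p → ℝ} (hy : y ∈ Ω) :
    HasFDerivAt f (∑ i, (ContinuousLinearMap.proj (R := ℝ) (φ := fun _ : Fin p => ℝ) i).smulRight
      (d i y)) y := by
  classical
  rw [hasFDerivAt_iff_isLittleO, Asymptotics.isLittleO_iff]
  intro c hc0
  obtain ⟨ε, hε, hεc⟩ : ∃ ε : ℝ, 0 < ε ∧ ε * p ≤ c := by
    refine ⟨c / (p + 1), by positivity, ?_⟩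
    rw [div_mul_eq_mul_div, div_le_iff₀ (by positivity)]
    nlinarith
  have hev : ∀ᶠ z in 𝓝 y, z ∈ Ω ∧ ∀ i, ‖d i z - d i y‖ ≤ ε := by
    refine (hΩ.eventually_mem hy).and (eventually_all.2 fun i => ?_)
    have hci : Tendsto (d i) (𝓝 y) (𝓝 (d i y)) := (hc i).continuousAt (hΩ.mem_nhds hy)
    filter_upwards [Metric.tendsto_nhds.1 hci ε hε] with z hz
    rw [← dist_eq_norm]
    exact hz.le
  obtain ⟨δ, hδ, hball⟩ := Metric.eventually_nhds_iff.1 hev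
  filter_upwards [Metric.ball_mem_nhds y hδ] with z hz
  have hz' : dist z y < δ := hz
  have key : ∀ s : Finset (Fin p),
      ‖f (s.piecewise z y) - f y - ∑ i ∈ s, (z i - y i) • d i y‖ ≤ ε * s.card * ‖z - y‖ := by
    intro s
    induction s using Finset.induction_on with
    | empty => simp
    | insert i s his ih =>
      set x := s.piecewise z y with hx
      have hxi : x i = y i := by simp [hx, his]
      have hup : (insert i s).piecewise z y = x + (z i - y i) • Pi.single i (1 : ℝ) := by
        ext j
        by_cases hj : j = i
        · subst hj; simp [hxi]
        · by_cases hjs : j ∈ s <;> simp [hx, hj, hjs]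
      have hin : ∀ t ∈ uIcc 0 (z i - y i), dist (x + t • Pi.single i (1 : ℝ)) y < δ := by
        intro t ht
        rw [dist_pi_lt_iff hδ]
        intro j
        have hzj := (dist_le_pi_dist z y j).trans_lt hz'
        by_cases hj : j = i
        · subst hj
          have : |t| ≤ |z j - y j| := by
            simpa using abs_sub_left_of_mem_uIcc ht
          simpa [hxi, Real.dist_eq] using this.trans_lt (by simpa [Real.dist_eq] using hzj)
        · by_cases hjs : j ∈ s
          · simpa [hx, hj, hjs] using hzj
          · simpa [hx, hj, hjs] using hδ
      have hmv := norm_sub_sub_smul_le_of_hasLineDerivAt (f := f) (d := d i) (c := d i y)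
        (x := x) (v := Pi.single i 1) (a := z i - y i) (ε := ε)
        (fun t ht => hd i _ (hball (hin t ht)).1) (fun t ht => (hball (hin t ht)).2 i)
      have hzi : |z i - y i| ≤ ‖z - y‖ := by simpa using norm_le_pi_norm (z - y) i
      rw [hup, Finset.sum_insert his, Finset.card_insert_of_notMem his]
      calc _ = ‖(f (x + (z i - y i) • Pi.single i (1 : ℝ)) - f x - (z i - y i) • d i y) +
            (f x - f y - ∑ j ∈ s, (z j - y j) • d j y)‖ := by congr 1; abel
        _ ≤ ε * |z i - y i| + ε * s.card * ‖z - y‖ := (norm_add_le _ _).trans (add_le_add hmv ih)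
        _ ≤ ε * ‖z - y‖ + ε * s.card * ‖z - y‖ := by gcongr
        _ = _ := by push_cast; ring
  have := key Finset.univ
  simp only [Finset.piecewise_univ, Finset.card_univ, Fintype.card_fin] at this
  refine le_trans (le_of_eq ?_) (this.trans ?_)
  · simp
  · gcongr

theorem fderiv_eq_sum_smulRight_partialD (x : Fin p → ℝ) :
    fderiv ℝ f x = ∑ i, (ContinuousLinearMap.proj (R := ℝ) (φ := fun _ : Fin p => ℝ) i).smulRight
      (partialD i f x) := by
  ext v
  conv_lhs => rw [pi_eq_sum_univ' v]
  simp [partialD, map_sum, map_smul]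

theorem contDiffOn_succ_of_partialD (hΩ : IsOpen Ω) {n : ℕ} (hf : DifferentiableOn ℝ f Ω)
    (h : ∀ i, ContDiffOn ℝ n (partialD i f) Ω) : ContDiffOn ℝ (n + 1 : ℕ) f Ω := by
  push_cast
  refine (contDiffOn_succ_iff_fderiv_of_isOpen hΩ).2 ⟨hf, by simp, ?_⟩
  refine (ContDiffOn.sum (s := Finset.univ) fun i _ =>
    (contDiffOn_const (c := ContinuousLinearMap.proj (R := ℝ) (φ := fun _ : Fin p => ℝ)
      i)).smulRight (h i)).congr fun x _ => ?_
  exact fderiv_eq_sum_smulRight_partialD x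

/-- A function whose partial derivatives exist and are continuous on an open set is `C¹`. -/
theorem contDiffOn_one_of_hasLineDerivAt_single (hΩ : IsOpen Ω) {d : Fin p → (Fin p → ℝ) → E}
    (hd : ∀ i, ∀ y ∈ Ω, HasLineDerivAt ℝ f (d i y) y (Pi.single i 1))
    (hc : ∀ i, ContinuousOn (d i) Ω) : ContDiffOn ℝ 1 f Ω := by
  have hf : DifferentiableOn ℝ f Ω := fun y hy =>
    (hasFDerivAt_of_hasLineDerivAt_single hΩ hd hc hy).differentiableAt.differentiableWithinAt
  refine contDiffOn_succ_of_partialD (n := 0) hΩ hf fun i => ?_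
  refine contDiffOn_zero.2 ((hc i).congr fun y hy => ?_)
  exact (((hf y hy).differentiableAt (hΩ.mem_nhds hy)).hasFDerivAt.hasLineDerivAt _).unique
    (hd i y hy)

theorem ContDiffOn.partialD (hΩ : IsOpen Ω) {n : ℕ} (hf : ContDiffOn ℝ (n + 1 : ℕ) f Ω)
    (i : Fin p) : ContDiffOn ℝ n (partialD i f) Ω :=
  (hf.fderiv_of_isOpen hΩ (by norm_cast)).clm_apply contDiffOn_const

theorem Set.EqOn.partialD (hΩ : IsOpen Ω) (h : EqOn f g Ω) (i : Fin p) :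
    EqOn (partialD i f) (partialD i g) Ω := fun x hx => by
  have : f =ᶠ[𝓝 x] g := h.eventuallyEq_of_mem (hΩ.mem_nhds hx)
  simp only [_root_.partialD, this.fderiv_eq]

theorem partialD_comm (hΩ : IsOpen Ω) (hf : ContDiffOn ℝ 2 f Ω) (i j : Fin p) :
    EqOn (partialD i (partialD j f)) (partialD j (partialD i f)) Ω := by
  intro x hx
  have hfx : ContDiffAt ℝ 2 f x := hf.contDiffAt (hΩ.mem_nhds hx)
  have hdiff : DifferentiableAt ℝ (fderiv ℝ f) x :=
    (hfx.fderiv_right (m := 1) (by norm_num)).differentiableAt (by norm_num)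
  have key : ∀ v w : Fin p → ℝ,
      fderiv ℝ (fun z => fderiv ℝ f z v) x w = fderiv ℝ (fderiv ℝ f) x w v := by
    intro v w
    rw [fderiv_clm_apply hdiff (differentiableAt_const v)]
    simp
  refine (key _ _).trans (Eq.trans ?_ (key _ _).symm)
  exact hfx.isSymmSndFDerivAt (by simp) _ _

/-- The iterated partial derivative along a word of coordinate indices, first letter outermost. -/
noncomputable def partialDWord (l : List (Fin p)) (f : (Fin p → ℝ) → E) : (Fin p → ℝ) → E :=
  l.foldr partialD f

theorem ContDiffOn.partialDWord (hΩ : IsOpen Ω) (l : List (Fin p)) {n : ℕ}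
    (hf : ContDiffOn ℝ (n + l.length : ℕ) f Ω) : ContDiffOn ℝ n (partialDWord l f) Ω := by
  induction l generalizing n with
  | nil => simpa [_root_.partialDWord] using hf
  | cons i l ih =>
    refine ContDiffOn.partialD hΩ (ih (hf.of_le ?_)) i
    norm_cast
    simp only [List.length_cons]
    omega

theorem List.Perm.eqOn_partialDWord (hΩ : IsOpen Ω) {l l' : List (Fin p)} (h : l.Perm l')
    (hf : ContDiffOn ℝ l.length f Ω) : EqOn (partialDWord l f) (partialDWord l' f) Ω := by
  induction h with
  | nil => exact fun _ _ => rfl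
  | cons i _ ih =>
    refine (ih (hf.of_le ?_)).partialD hΩ i
    norm_cast
    simp
  | swap i j l =>
    refine partialD_comm hΩ ?_ j i
    refine ContDiffOn.partialDWord (n := 2) hΩ l (hf.of_le ?_)
    norm_cast
    simp only [List.length_cons]
    omega
  | trans h₁ _ ih₁ ih₂ => exact (ih₁ hf).trans (ih₂ (by rwa [← h₁.length_eq]))

theorem pdMulti_eq_partialDWord (lam : Fin p → ℕ) (f : (Fin p → ℝ) → E) :
    pdMulti lam f =
      partialDWord ((List.finRange p).flatMap fun i => List.replicate (lam i) i) f := by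
  have hrep : ∀ (i : Fin p) (k : ℕ) (g : (Fin p → ℝ) → E),
      (partialD i)^[k] g = (List.replicate k i).foldr partialD g := by
    intro i k g
    induction k with
    | zero => rfl
    | succ k ih => rw [Function.iterate_succ_apply', ih, List.replicate_succ, List.foldr_cons]
  unfold pdMulti partialDWord
  induction List.finRange p with
  | nil => rfl
  | cons i l ih => rw [List.foldr_cons, ih, hrep, List.flatMap_cons, List.foldr_append]

theorem perm_flatMap_replicate_count (l : List (Fin p)) :
    l.Perm ((List.finRange p).flatMap fun i => List.replicate (l.count i) i) := by
  rw [List.perm_iff_count]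
  intro a
  rw [List.count_flatMap, ← Fin.sum_univ_def]
  simp [List.count_replicate]

theorem eqOn_partialDWord_pdMulti (hΩ : IsOpen Ω) (l : List (Fin p))
    (hf : ContDiffOn ℝ l.length f Ω) :
    EqOn (partialDWord l f) (pdMulti (fun i => l.count i) f) Ω := by
  rw [pdMulti_eq_partialDWord]
  exact (perm_flatMap_replicate_count l).eqOn_partialDWord hΩ hf

end PartialDerivatives

section StrongDerivatives

variable {Ω : Set (Fin p → ℝ)} {J K : (Fin p → ℝ) → (E →L[ℝ] F)} {g : (Fin p → ℝ) → E}

theorem IsSC1.congr (hΩ : IsOpen Ω) (hK : IsSC1 Ω K) (h : EqOn J K Ω) : IsSC1 Ω J := by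
  obtain ⟨hc, K', hd, hc'⟩ := hK
  refine ⟨hc.congr h, K', fun i e y hy => ?_, hc'⟩
  refine (hd i e y hy).congr_of_eventuallyEq ?_
  filter_upwards [hΩ.mem_nhds hy] with z hz
  rw [h hz]

/-- A strongly continuous family of operators on an open set is locally bounded, hence acts
continuously on continuous maps. -/
theorem ContinuousOn.clm_apply_of_strong [CompleteSpace E] (hΩ : IsOpen Ω)
    (hK : ∀ e, ContinuousOn (fun y => K y e) Ω) (hg : ContinuousOn g Ω) :
    ContinuousOn (fun y => K y (g y)) Ω := by
  intro y hy
  refine ContinuousAt.continuousWithinAt ?_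
  obtain ⟨S, hSc, hSy, hSΩ⟩ := exists_compact_subset hΩ hy
  obtain ⟨C, hC⟩ : ∃ C, ∀ z : S, ‖K z‖ ≤ C := by
    refine banach_steinhaus fun e => ?_
    obtain ⟨C, hC⟩ := hSc.exists_bound_of_continuousOn ((hK e).mono hSΩ)
    exact ⟨C, fun z => hC z z.2⟩
  have hgy : Tendsto (fun z => g z - g y) (𝓝 y) (𝓝 0) :=
    tendsto_sub_nhds_zero_iff.2 (hg.continuousAt (hΩ.mem_nhds hy))
  have h1 : Tendsto (fun z => K z (g z - g y)) (𝓝 y) (𝓝 0) := by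
    refine squeeze_zero_norm' (a := fun z => C * ‖g z - g y‖) ?_ ?_
    · filter_upwards [mem_interior_iff_mem_nhds.1 hSy] with z hz
      exact (K z).le_of_opNorm_le (hC ⟨z, hz⟩) _
    · simpa using hgy.norm.const_mul C
  have h2 : Tendsto (fun z => K z (g y)) (𝓝 y) (𝓝 (K y (g y))) :=
    (hK (g y)).continuousAt (hΩ.mem_nhds hy)
  simpa [ContinuousAt] using h1.add h2

/-- Product rule for a norm-continuous family of operators which is only strongly
differentiable. -/
theorem HasDerivAt.clm_apply_of_strong {A : ℝ → (E →L[ℝ] F)} {u : ℝ → E} {u' : E} {w : F} {t : ℝ}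
    (hA : ContinuousAt A t) (hAu : HasDerivAt (fun s => A s (u t)) w t) (hu : HasDerivAt u u' t) :
    HasDerivAt (fun s => A s (u s)) (w + A t u') t := by
  rw [hasDerivAt_iff_tendsto_slope] at *
  have hA' : Tendsto A (𝓝[≠] t) (𝓝 (A t)) := hA.mono_left nhdsWithin_le_nhds
  have h := hAu.add (((isBoundedBilinearMap_apply (𝕜 := ℝ) (E := E) (F := F)).continuous.tendsto
    (A t, u')).comp (hA'.prodMk_nhds hu))
  refine h.congr fun s => ?_
  simp only [slope_def_module, Function.comp_apply, map_smul, map_sub, ← smul_add]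
  congr 1
  abel

theorem IsSC1.contDiffOn_clm_apply [CompleteSpace E] (hΩ : IsOpen Ω) (hJ : IsSC1 Ω J)
    (hg : ContDiffOn ℝ 1 g Ω) : ContDiffOn ℝ 1 (fun y => J y (g y)) Ω := by
  obtain ⟨hc, K', hd, hc'⟩ := hJ
  refine contDiffOn_one_of_hasLineDerivAt_single hΩ
    (d := fun i y => K' i y (g y) + J y (partialD i g y)) (fun i y hy => ?_) fun i => ?_
  · have hline : ContinuousAt (fun t : ℝ => y + t • (Pi.single i 1 : Fin p → ℝ)) 0 := by fun_prop
    have hJy : ContinuousAt (fun t : ℝ => J (y + t • (Pi.single i 1 : Fin p → ℝ))) 0 :=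
      ContinuousAt.comp_of_eq (hc.continuousAt (hΩ.mem_nhds hy)) hline (by simp)
    have hgy : HasLineDerivAt ℝ g (partialD i g y) y (Pi.single i 1) :=
      ((hg.differentiableOn (by norm_num)).differentiableAt
        (hΩ.mem_nhds hy)).hasFDerivAt.hasLineDerivAt _
    have := HasDerivAt.clm_apply_of_strong
      (A := fun t : ℝ => J (y + t • (Pi.single i 1 : Fin p → ℝ)))
      hJy (by simpa [HasLineDerivAt] using hd i (g y) y hy) hgy
    simpa [HasLineDerivAt] using this
  · have hgi : ContinuousOn (partialD i g) Ω :=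
      (ContDiffOn.partialD (n := 0) hΩ (by simpa using hg) i).continuousOn
    exact (ContinuousOn.clm_apply_of_strong hΩ (hc' i) hg.continuousOn).add (hc.clm_apply hgi)

theorem contDiffOn_clm_apply_of_partialDWord [CompleteSpace E] (hΩ : IsOpen Ω) {n : ℕ}
    (hJ : ContDiffOn ℝ n J Ω)
    (hJs : ∀ l : List (Fin p), l.length = n → IsSC1 Ω (partialDWord l J))
    (hg : ContDiffOn ℝ (n + 1 : ℕ) g Ω) :
    ContDiffOn ℝ (n + 1 : ℕ) (fun y => J y (g y)) Ω := by
  induction n generalizing J g with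
  | zero => simpa [partialDWord] using (hJs [] rfl).contDiffOn_clm_apply hΩ (by simpa using hg)
  | succ n ih =>
    have hJd : DifferentiableOn ℝ J Ω := hJ.differentiableOn (by norm_cast)
    have hgd : DifferentiableOn ℝ g Ω := hg.differentiableOn (by norm_cast)
    refine contDiffOn_succ_of_partialD hΩ (hJd.clm_apply hgd) fun i => ?_
    have h1 : ContDiffOn ℝ (n + 1 : ℕ) (fun y => partialD i J y (g y)) Ω := by
      refine ih (hJ.partialD hΩ i) (fun l hl => ?_) (hg.of_le (by norm_cast; omega))
      simpa [partialDWord] using hJs (l ++ [i]) (by simp [hl])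
    refine (h1.add (hJ.clm_apply (hg.partialD hΩ i))).congr fun y hy => ?_
    have hy' := hΩ.mem_nhds hy
    simp [partialD, fderiv_clm_apply (hJd.differentiableAt hy') (hgd.differentiableAt hy'),
      add_comm]

theorem IsSCn.contDiffOn_clm_apply [CompleteSpace E] (hΩ : IsOpen Ω) {n : ℕ} (hn : 1 ≤ n)
    (hJ : IsSCn n Ω J) (hg : ContDiffOn ℝ n g Ω) :
    ContDiffOn ℝ n (fun y => J y (g y)) Ω := by
  obtain ⟨m, rfl⟩ := Nat.exists_eq_add_of_le' hn
  obtain ⟨hJc, hJs⟩ := hJ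
  rw [Nat.add_sub_cancel] at hJc hJs
  refine contDiffOn_clm_apply_of_partialDWord hΩ hJc (fun l hl => ?_) hg
  subst hl
  have hcount : ∑ i, l.count i = l.length := by
    simpa using Multiset.sum_count_eq_card (s := Finset.univ) (m := (l : Multiset (Fin p)))
      fun a _ => Finset.mem_univ a
  exact (hJs (fun i => l.count i) hcount).congr hΩ (eqOn_partialDWord_pdMulti hΩ l hJc)

end StrongDerivatives

end

/-- if `J : Ω' → L(E, F)` is of class `s-Cⁿ` and `h : Ω' → Ω` is a `Cⁿ`
diffeomorphism, then for every `f ∈ C^n(Ω, E)` the function `y ↦ (Jy)(f(h(y)))` belongs to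
`C^n(Ω', F)`. -/
theorem weighted_composition_contDiffOn {p n : ℕ} {E F : Type*}
    [NormedAddCommGroup E] [NormedSpace ℝ E] [CompleteSpace E]
    [NormedAddCommGroup F] [NormedSpace ℝ F] [CompleteSpace F]
    {Ω Ω' : Set (Fin p → ℝ)}
    (hΩ : IsOpen Ω) (hΩne : Ω.Nonempty) (hΩ' : IsOpen Ω') (hΩ'ne : Ω'.Nonempty)
    (hn : 1 ≤ n)
    (J : (Fin p → ℝ) → (E →L[ℝ] F)) (hJ : IsSCn n Ω' J)
    (h : (Fin p → ℝ) → (Fin p → ℝ)) (h' : (Fin p → ℝ) → (Fin p → ℝ))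
    (hhBij : Set.BijOn h Ω' Ω) (hh : ContDiffOn ℝ n h Ω') (hh' : ContDiffOn ℝ n h' Ω)
    (hinv1 : ∀ y ∈ Ω', h' (h y) = y) (hinv2 : ∀ x ∈ Ω, h (h' x) = x)
    (f : (Fin p → ℝ) → E) (hf : ContDiffOn ℝ n f Ω) :
    ContDiffOn ℝ n (fun y => J y (f (h y))) Ω' := by
  exact hJ.contDiffOn_clm_apply hΩ' hn (hf.comp hh hhBij.mapsTo)
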